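/- Let 0 < δ ≤ δ̄, let C : [0,1] → Matrix (Fin D) (Fin D) ℝ be continuous with δ|y|² ≤ yᵀC(t)C(t)ᵀy ≤ δ̄|y|² for all y ∈ ℝ^D, t ∈ [0,1], set Σ(t,s) := ∫_t^s C(u)C(u)ᵀ du with Cholesky factor L(t,s). Let α ∈ (0,1), T ∈ (0,1], and let φ : ℝ^D → ℝ be a function with finite Hölder seminorm [φ]_α := sup_{x≠y}|φ(x)−φ(y)|/|x−y|^α. Then there is a constant c > 0 depending only on δ, δ̄, D, α such that for all 0 ≤ t₁ < t₂ < T and all y₁, y₂ ∈ ℝ^D: | ∫_{ℝ^D} (2π)^{−D/2} e^{−|z|²/2} ( φ(y₁ − L(t₁,T)z) − φ(y₂ − L(t₂,T)z) ) dz | ≤ c [φ]_α ( |y₁−y₂|^α + (t₂−t₁)^{α/2} ). -/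

import Mathlib

noncomputable section

open Real Set Matrix

/-- `Sig C t s = ∫_t^s C(u) C(u)ᵀ du` (entrywise Bochner integral). -/
noncomputable def Sig {D : ℕ} (C : ℝ → Matrix (Fin D) (Fin D) ℝ) (t s : ℝ) :
    Matrix (Fin D) (Fin D) ℝ :=
  fun i j => ∫ u in t..s, (C u * (C u)ᵀ) i j

/-- Uniform ellipticity: `δ |y|² ≤ yᵀ C(t)C(t)ᵀ y ≤ δ' |y|²` for all `t ∈ [0,1]`. -/
def Ellip (D : ℕ) (δ δ' : ℝ) (C : ℝ → Matrix (Fin D) (Fin D) ℝ) : Prop :=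
  ∀ t ∈ Set.Icc (0:ℝ) 1, ∀ y : Fin D → ℝ,
    δ * (∑ i, y i ^ 2) ≤ (∑ i, ∑ j, y i * (C t * (C t)ᵀ) i j * y j) ∧
    (∑ i, ∑ j, y i * (C t * (C t)ᵀ) i j * y j) ≤ δ' * (∑ i, y i ^ 2)

/-- Euclidean norm on `ℝ^D`. -/
noncomputable def en {D : ℕ} (x : Fin D → ℝ) : ℝ := Real.sqrt (∑ i, x i ^ 2)

/-- The set of `α`-Hölder quotients of `φ : ℝ^D → ℝ`. -/
def hsemiSet {D : ℕ} (α : ℝ) (φ : (Fin D → ℝ) → ℝ) : Set ℝ :=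
  {r | ∃ x y, x ≠ y ∧ r = |φ x - φ y| / en (x - y) ^ α}

/-- `L` is the Cholesky factor of `Sig C` at `(t,s)`. -/
def IsCholesky {D : ℕ} (C : ℝ → Matrix (Fin D) (Fin D) ℝ)
    (L : ℝ → ℝ → Matrix (Fin D) (Fin D) ℝ) : Prop :=
  ∀ t s : ℝ, 0 ≤ t → t < s → s ≤ 1 →
    (∀ i j : Fin D, i < j → L t s i j = 0) ∧ (∀ i, 0 < L t s i i) ∧
    Sig C t s = L t s * (L t s)ᵀ

theorem mul_transpose_apply_self {n : Type*} [Fintype n] (X : Matrix n n ℝ) (i : n) :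
    (X * Xᵀ) i i = ∑ j, X i j ^ 2 := by
  simp only [Matrix.mul_apply, Matrix.transpose_apply, sq]

/-- Diagonal entries of a congruence `P S Pᵀ` are values of the quadratic form of `S`. -/
theorem mul_mul_transpose_apply_self {n : Type*} [Fintype n] (P S : Matrix n n ℝ) (i : n) :
    (P * S * Pᵀ) i i = P i ⬝ᵥ S *ᵥ P i := by
  rw [Matrix.mul_assoc, Matrix.mul_apply]
  simp only [dotProduct, mulVec, Matrix.mul_apply, Matrix.transpose_apply]

/-- The diagonal of a product of lower triangular matrices. -/
theorem mul_apply_self_of_lower {D : ℕ} {A B : Matrix (Fin D) (Fin D) ℝ}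
    (hA : ∀ i j, i < j → A i j = 0) (hB : ∀ i j, i < j → B i j = 0) (i : Fin D) :
    (A * B) i i = A i i * B i i := by
  rw [Matrix.mul_apply]
  refine Finset.sum_eq_single i (fun k _ hk => ?_) (by simp)
  rcases lt_or_gt_of_ne hk with h | h
  · rw [hB k i h, mul_zero]
  · rw [hA i k h, zero_mul]

theorem isUnit_det_of_lower {D : ℕ} {A : Matrix (Fin D) (Fin D) ℝ}
    (hA : ∀ i j, i < j → A i j = 0) (hA' : ∀ i, 0 < A i i) : IsUnit A.det := by
  have h : A.BlockTriangular OrderDual.toDual := fun i j hij => hA i j hij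
  rw [Matrix.det_of_isLowerTriangular A h]
  exact (Finset.prod_pos fun i _ => hA' i).ne'.isUnit

theorem inv_apply_of_lower {D : ℕ} {A : Matrix (Fin D) (Fin D) ℝ}
    (hA : ∀ i j, i < j → A i j = 0) (hA' : ∀ i, 0 < A i i) (i j : Fin D) (hij : i < j) :
    A⁻¹ i j = 0 := by
  have h : A.BlockTriangular OrderDual.toDual := fun i j hij => hA i j hij
  have : Invertible A := A.invertibleOfIsUnitDet (isUnit_det_of_lower hA hA')
  exact Matrix.blockTriangular_inv_of_blockTriangular h hij

theorem mul_apply_of_lower {D : ℕ} {A B : Matrix (Fin D) (Fin D) ℝ}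
    (hA : ∀ i j, i < j → A i j = 0) (hB : ∀ i j, i < j → B i j = 0) (i j : Fin D)
    (hij : i < j) : (A * B) i j = 0 := by
  have hA' : A.BlockTriangular OrderDual.toDual := fun i j hij => hA i j hij
  have hB' : B.BlockTriangular OrderDual.toDual := fun i j hij => hB i j hij
  exact hA'.mul hB' hij

/-- The quadratic form of `L Lᵀ` takes the value one at the rows of `L⁻¹`. -/
theorem inv_row_quadratic_form_eq_one {D : ℕ} {A : Matrix (Fin D) (Fin D) ℝ}
    (hA : IsUnit A.det) (i : Fin D) : A⁻¹ i ⬝ᵥ (A * Aᵀ) *ᵥ A⁻¹ i = 1 := by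
  rw [← mul_mul_transpose_apply_self, ← Matrix.mul_assoc, Matrix.nonsing_inv_mul _ hA,
    Matrix.one_mul, ← Matrix.transpose_mul, Matrix.nonsing_inv_mul _ hA]
  simp

/-- Cholesky diagonals are monotone in the Loewner order. -/
theorem cholesky_diag_mono {D : ℕ} {A B : Matrix (Fin D) (Fin D) ℝ}
    (hA : ∀ i j, i < j → A i j = 0) (hA' : ∀ i, 0 < A i i)
    (hB : ∀ i j, i < j → B i j = 0)
    (hAB : ∀ w, w ⬝ᵥ (B * Bᵀ) *ᵥ w ≤ w ⬝ᵥ (A * Aᵀ) *ᵥ w) (i : Fin D) : B i i ≤ A i i := by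
  have hu := isUnit_det_of_lower hA hA'
  have hinv := inv_apply_of_lower hA hA'
  have hN := mul_apply_of_lower hinv hB
  have hprod : A i i * (A⁻¹ * B) i i = B i i := by
    rw [← mul_apply_self_of_lower hA hN, ← Matrix.mul_assoc, Matrix.mul_nonsing_inv _ hu,
      Matrix.one_mul]
  have hle : (A⁻¹ * B) i i ^ 2 ≤ 1 := by
    calc (A⁻¹ * B) i i ^ 2 ≤ ∑ k, (A⁻¹ * B) i k ^ 2 :=
          Finset.single_le_sum (f := fun k => (A⁻¹ * B) i k ^ 2) (fun k _ => sq_nonneg _)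
            (Finset.mem_univ i)
      _ = (A⁻¹ * B * (A⁻¹ * B)ᵀ) i i := (mul_transpose_apply_self _ _).symm
      _ = A⁻¹ i ⬝ᵥ (B * Bᵀ) *ᵥ A⁻¹ i := by
          rw [← mul_mul_transpose_apply_self, Matrix.transpose_mul]
          simp only [Matrix.mul_assoc]
      _ ≤ 1 := (hAB _).trans_eq (inv_row_quadratic_form_eq_one hu i)
  nlinarith [hA' i, (sq_le_one_iff_abs_le_one _).1 hle, le_abs_self ((A⁻¹ * B) i i)]

theorem sum_sq_mul_le {n : Type*} [Fintype n] (A B : Matrix n n ℝ) :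
    ∑ i, ∑ j, (A * B) i j ^ 2 ≤ (∑ i, ∑ j, A i j ^ 2) * ∑ i, ∑ j, B i j ^ 2 := by
  calc ∑ i, ∑ j, (A * B) i j ^ 2
      ≤ ∑ i, ∑ j, (∑ k, A i k ^ 2) * ∑ k, B k j ^ 2 := by
        gcongr with i _ j _
        rw [Matrix.mul_apply]
        exact Finset.sum_mul_sq_le_sq_mul_sq _ _ _
    _ = _ := by
        rw [Finset.sum_comm (f := fun i j => B i j ^ 2), Finset.sum_mul_sum]

/-- Frobenius perturbation bound for Cholesky factors under a nonnegative perturbation. -/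
theorem cholesky_perturbation {D : ℕ} {A B : Matrix (Fin D) (Fin D) ℝ} {m p e : ℝ}
    (hA : ∀ i j, i < j → A i j = 0) (hA' : ∀ i, 0 < A i i)
    (hB : ∀ i j, i < j → B i j = 0) (hB' : ∀ i, 0 < B i i) (hm : 0 < m) (he : 0 ≤ e)
    (hAB : ∀ w, w ⬝ᵥ (B * Bᵀ) *ᵥ w ≤ w ⬝ᵥ (A * Aᵀ) *ᵥ w)
    (hupper : ∀ w, w ⬝ᵥ (A * Aᵀ) *ᵥ w ≤ w ⬝ᵥ (B * Bᵀ) *ᵥ w + e * ∑ i, w i ^ 2)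
    (hlower : ∀ w, m * ∑ i, w i ^ 2 ≤ w ⬝ᵥ (B * Bᵀ) *ᵥ w)
    (hdiag : ∀ i, (B * Bᵀ) i i ≤ p) :
    ∑ i, ∑ j, (A - B) i j ^ 2 ≤ (D * p) * (D * (e / m)) := by
  have hu := isUnit_det_of_lower hB hB'
  have hM := mul_apply_of_lower (inv_apply_of_lower hB hB') hA
  set M := B⁻¹ * A with hMdef
  have hBM : B * M = A := by
    rw [hMdef, ← Matrix.mul_assoc, Matrix.mul_nonsing_inv _ hu, Matrix.one_mul]
  have hone : ∀ i, 1 ≤ M i i := fun i => by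
    have h : B i i * M i i = A i i := by rw [← mul_apply_self_of_lower hB hM, hBM]
    have := cholesky_diag_mono hA hA' hB hAB i
    nlinarith [hB' i]
  have hrow : ∀ i, ∑ j, M i j ^ 2 ≤ 1 + e / m := fun i => by
    have h1 := inv_row_quadratic_form_eq_one hu i
    have h2 := hlower (B⁻¹ i)
    have h3 := hupper (B⁻¹ i)
    have h4 : ∑ j, M i j ^ 2 = B⁻¹ i ⬝ᵥ (A * Aᵀ) *ᵥ B⁻¹ i := by
      rw [← mul_mul_transpose_apply_self]
      have : B⁻¹ * (A * Aᵀ) * B⁻¹ᵀ = M * Mᵀ := by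
        rw [hMdef, Matrix.transpose_mul]
        simp only [Matrix.mul_assoc]
      rw [this, mul_transpose_apply_self]
    have h5 : ∑ k, B⁻¹ i k ^ 2 ≤ 1 / m := by
      rw [le_div_iff₀ hm]
      linarith
    calc ∑ j, M i j ^ 2 ≤ 1 + e * ∑ k, B⁻¹ i k ^ 2 := by linarith
      _ ≤ 1 + e * (1 / m) := by gcongr
      _ = 1 + e / m := by ring
  have hrow' : ∀ i, ∑ j, (M - 1) i j ^ 2 ≤ e / m := fun i => by
    have : ∑ j, (M - 1) i j ^ 2 = ∑ j, M i j ^ 2 - 2 * M i i + 1 := by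
      simp only [Matrix.sub_apply, sub_sq, Finset.sum_add_distrib, Finset.sum_sub_distrib,
        Matrix.one_apply]
      simp
    linarith [hrow i, hone i]
  have hF : ∑ i, ∑ j, B i j ^ 2 ≤ D * p := by
    have : ∀ i, ∑ j, B i j ^ 2 ≤ p := fun i =>
      (mul_transpose_apply_self B i).symm.trans_le (hdiag i)
    simpa using Finset.sum_le_sum fun i (_ : i ∈ Finset.univ) => this i
  have hG : ∑ i, ∑ j, (M - 1) i j ^ 2 ≤ D * (e / m) := by
    simpa using Finset.sum_le_sum fun i (_ : i ∈ Finset.univ) => hrow' i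
  have hsub : A - B = B * (M - 1) := by rw [Matrix.mul_sub, hBM, Matrix.mul_one]
  rw [hsub]
  refine (sum_sq_mul_le _ _).trans (mul_le_mul hF hG ?_ ?_)
  · positivity
  · exact le_trans (by positivity) hF

theorem continuous_mul_transpose_apply {D : ℕ} {C : ℝ → Matrix (Fin D) (Fin D) ℝ}
    (hC : Continuous C) (i j : Fin D) : Continuous fun u => (C u * (C u)ᵀ) i j :=
  (hC.matrix_mul hC.matrix_transpose).matrix_elem i j

theorem Sig_add {D : ℕ} {C : ℝ → Matrix (Fin D) (Fin D) ℝ} (hC : Continuous C) (r t s : ℝ) :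
    Sig C r s = Sig C r t + Sig C t s := by
  ext i j
  have h := continuous_mul_transpose_apply hC i j
  exact (intervalIntegral.integral_add_adjacent_intervals (h.intervalIntegrable _ _)
    (h.intervalIntegrable _ _)).symm

theorem dotProduct_Sig_mulVec {D : ℕ} {C : ℝ → Matrix (Fin D) (Fin D) ℝ} (hC : Continuous C)
    (t s : ℝ) (w : Fin D → ℝ) :
    w ⬝ᵥ Sig C t s *ᵥ w = ∫ u in t..s, ∑ i, ∑ j, w i * (C u * (C u)ᵀ) i j * w j := by
  have h := continuous_mul_transpose_apply hC
  rw [intervalIntegral.integral_finsetSum fun i _ =>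
    Continuous.intervalIntegrable (by fun_prop) _ _]
  simp only [dotProduct, mulVec, Finset.mul_sum, Sig]
  refine Finset.sum_congr rfl fun i _ => ?_
  rw [intervalIntegral.integral_finsetSum fun j _ =>
    Continuous.intervalIntegrable (by fun_prop) _ _]
  refine Finset.sum_congr rfl fun j _ => ?_
  rw [intervalIntegral.integral_mul_const, intervalIntegral.integral_const_mul]
  ring

theorem Ellip.dotProduct_Sig_bounds {D : ℕ} {δ δ' : ℝ} {C : ℝ → Matrix (Fin D) (Fin D) ℝ}
    (hE : Ellip D δ δ' C) (hC : Continuous C) {t s : ℝ} (ht : 0 ≤ t) (hts : t ≤ s)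
    (hs : s ≤ 1) (w : Fin D → ℝ) :
    (δ * (s - t)) * ∑ i, w i ^ 2 ≤ w ⬝ᵥ Sig C t s *ᵥ w ∧
      w ⬝ᵥ Sig C t s *ᵥ w ≤ (δ' * (s - t)) * ∑ i, w i ^ 2 := by
  have h := continuous_mul_transpose_apply hC
  have hint : IntervalIntegrable (fun u => ∑ i, ∑ j, w i * (C u * (C u)ᵀ) i j * w j)
      MeasureTheory.volume t s := Continuous.intervalIntegrable (by fun_prop) _ _
  have hE' := fun u (hu : u ∈ Set.Icc t s) => hE u ⟨ht.trans hu.1, hu.2.trans hs⟩ w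
  rw [dotProduct_Sig_mulVec hC]
  constructor
  · have := intervalIntegral.integral_mono_on hts intervalIntegrable_const hint
      fun u hu => (hE' u hu).1
    rw [intervalIntegral.integral_const, smul_eq_mul] at this
    linarith
  · have := intervalIntegral.integral_mono_on hts hint intervalIntegrable_const
      fun u hu => (hE' u hu).2
    rw [intervalIntegral.integral_const, smul_eq_mul] at this
    linarith

/-- Cholesky factors of `Sig C` are `1/2`-Hölder in the initial time, in Frobenius norm. -/
theorem IsCholesky.sum_sq_sub_le {D : ℕ} {δ δ' : ℝ} (hδ : 0 < δ) (hδδ : δ ≤ δ')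
    {C : ℝ → Matrix (Fin D) (Fin D) ℝ} (hC : Continuous C) (hE : Ellip D δ δ' C)
    {L : ℝ → ℝ → Matrix (Fin D) (Fin D) ℝ} (hL : IsCholesky C L) {t₁ t₂ T : ℝ}
    (h₁ : 0 ≤ t₁) (h₁₂ : t₁ < t₂) (h₂ : t₂ < T) (hT : T ≤ 1) :
    ∑ i, ∑ j, (L t₁ T - L t₂ T) i j ^ 2 ≤ (D ^ 2 * δ' ^ 2 / δ) * (t₂ - t₁) := by
  obtain ⟨a1, a2, a3⟩ := hL t₁ T h₁ (h₁₂.trans h₂) hT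
  obtain ⟨b1, b2, b3⟩ := hL t₂ T (h₁.trans h₁₂.le) h₂ hT
  have hadd := Sig_add hC t₁ t₂ T
  have hS := hE.dotProduct_Sig_bounds hC (h₁.trans h₁₂.le) h₂.le hT
  have hΔ := hE.dotProduct_Sig_bounds hC h₁ h₁₂.le (h₂.le.trans hT)
  have hδ' : 0 < δ' := hδ.trans_le hδδ
  have hh : 0 < t₂ - t₁ := sub_pos.2 h₁₂
  have hτ : 0 < T - t₂ := sub_pos.2 h₂
  have hquad : ∀ w : Fin D → ℝ, w ⬝ᵥ Sig C t₁ T *ᵥ w =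
      w ⬝ᵥ Sig C t₁ t₂ *ᵥ w + w ⬝ᵥ Sig C t₂ T *ᵥ w := fun w => by
    rw [hadd, Matrix.add_mulVec, dotProduct_add]
  have key := cholesky_perturbation (m := δ * (T - t₂)) (p := δ' * (T - t₂))
    (e := δ' * (t₂ - t₁)) a1 a2 b1 b2 (by positivity) (by positivity)
    (fun w => by
      rw [← a3, ← b3, hquad]
      have : 0 ≤ (δ * (t₂ - t₁)) * ∑ i, w i ^ 2 := by positivity
      linarith [(hΔ w).1])
    (fun w => by
      rw [← a3, ← b3, hquad]
      linarith [(hΔ w).2])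
    (fun w => by
      rw [← b3]
      exact (hS w).1)
    (fun i => by
      rw [← b3]
      have := (hS (Pi.single i 1)).2
      simpa [Pi.single_apply, ite_pow] using this)
  refine key.trans_eq ?_
  field_simp

theorem en_eq_norm {D : ℕ} (x : Fin D → ℝ) : en x = ‖WithLp.toLp 2 x‖ := by
  simp [en, EuclideanSpace.norm_eq]

theorem en_nonneg {D : ℕ} (x : Fin D → ℝ) : 0 ≤ en x := Real.sqrt_nonneg _

theorem en_sub_le {D : ℕ} (x y : Fin D → ℝ) : en (x - y) ≤ en x + en y := by
  simp only [en_eq_norm, WithLp.toLp_sub]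
  exact norm_sub_le _ _

theorem en_mulVec_le {D : ℕ} (A : Matrix (Fin D) (Fin D) ℝ) (z : Fin D → ℝ) :
    en (A *ᵥ z) ≤ Real.sqrt (∑ i, ∑ j, A i j ^ 2) * en z := by
  rw [en, en, ← Real.sqrt_mul (by positivity)]
  refine Real.sqrt_le_sqrt ?_
  rw [Finset.sum_mul]
  exact Finset.sum_le_sum fun i _ => Finset.sum_mul_sq_le_sq_mul_sq Finset.univ (A i) z

theorem hsemiSet_sSup_nonneg {D : ℕ} (α : ℝ) (φ : (Fin D → ℝ) → ℝ) :
    0 ≤ sSup (hsemiSet α φ) := by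
  refine Real.sSup_nonneg ?_
  rintro r ⟨x, y, -, rfl⟩
  exact div_nonneg (abs_nonneg _) (Real.rpow_nonneg (en_nonneg _) _)

theorem abs_sub_le_hsemi {D : ℕ} {α : ℝ} {φ : (Fin D → ℝ) → ℝ}
    (hφ : BddAbove (hsemiSet α φ)) (x y : Fin D → ℝ) :
    |φ x - φ y| ≤ sSup (hsemiSet α φ) * en (x - y) ^ α := by
  rcases eq_or_ne x y with rfl | hxy
  · simpa using mul_nonneg (hsemiSet_sSup_nonneg α φ) (Real.rpow_nonneg (en_nonneg _) _)
  · have hpos : 0 < en (x - y) := by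
      rw [en_eq_norm, norm_pos_iff]
      simpa [sub_eq_zero] using hxy
    rw [← div_le_iff₀ (Real.rpow_pos_of_pos hpos _)]
    exact le_csSup hφ ⟨x, y, hxy, rfl⟩

theorem integrable_exp_neg_sum_sq {ι : Type*} [Fintype ι] {b : ℝ} (hb : 0 < b) :
    MeasureTheory.Integrable fun z : ι → ℝ => Real.exp (-b * ∑ i, z i ^ 2) := by
  simp only [Finset.mul_sum, Real.exp_sum]
  exact MeasureTheory.Integrable.fintype_prod fun _ => integrable_exp_neg_mul_sq hb

theorem one_add_en_rpow_mul_exp_le {D : ℕ} {α : ℝ} (hα : α ∈ Set.Ioo (0 : ℝ) 1)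
    (z : Fin D → ℝ) :
    (1 + en z ^ α) * Real.exp (-(∑ i, z i ^ 2) / 2) ≤
      8 * Real.exp (-(1 / 4) * ∑ i, z i ^ 2) := by
  have hsq : en z ^ 2 = ∑ i, z i ^ 2 := Real.sq_sqrt (by positivity)
  have hrpow : en z ^ α ≤ 1 + en z := by
    rcases le_total (en z) 1 with h | h
    · linarith [Real.rpow_le_one (en_nonneg z) h hα.1.le, en_nonneg z]
    · have := Real.rpow_le_rpow_of_exponent_le h hα.2.le
      rw [Real.rpow_one] at this
      linarith
  rw [← hsq]
  have hexp := Real.add_one_le_exp (en z ^ 2 / 4)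
  have hle : 1 + en z ^ α ≤ 8 * Real.exp (en z ^ 2 / 4) := by
    nlinarith [sq_nonneg (en z - 1)]
  calc (1 + en z ^ α) * Real.exp (-(en z ^ 2) / 2)
      ≤ 8 * Real.exp (en z ^ 2 / 4) * Real.exp (-(en z ^ 2) / 2) := by gcongr
    _ = 8 * Real.exp (-(1 / 4) * en z ^ 2) := by
        rw [mul_assoc, ← Real.exp_add]
        ring_nf

theorem stmt12 (D : ℕ) (δ δ' α : ℝ) (hδ : 0 < δ) (hδδ : δ ≤ δ')
    (hα : α ∈ Set.Ioo (0:ℝ) 1) :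
    ∃ c > 0, ∀ C : ℝ → Matrix (Fin D) (Fin D) ℝ, Continuous C → Ellip D δ δ' C →
      ∀ L : ℝ → ℝ → Matrix (Fin D) (Fin D) ℝ, IsCholesky C L →
      ∀ T ∈ Set.Ioc (0:ℝ) 1,
      ∀ φ : (Fin D → ℝ) → ℝ, BddAbove (hsemiSet α φ) →
      ∀ t₁ t₂ : ℝ, 0 ≤ t₁ → t₁ < t₂ → t₂ < T →
      ∀ y₁ y₂ : Fin D → ℝ,
        |∫ z : Fin D → ℝ,
            (2 * Real.pi) ^ (-(D : ℝ) / 2) * Real.exp (-(∑ i, z i ^ 2) / 2) *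
              (φ (fun i => y₁ i - ∑ k, L t₁ T i k * z k) -
                φ (fun i => y₂ i - ∑ k, L t₂ T i k * z k))| ≤
          c * sSup (hsemiSet α φ) * (en (y₁ - y₂) ^ α + (t₂ - t₁) ^ (α / 2)) := by
  set κ : ℝ := D ^ 2 * δ' ^ 2 / δ with hκ
  have hκ0 : 0 ≤ κ := by positivity
  set g : (Fin D → ℝ) → ℝ := fun z =>
    (2 * Real.pi) ^ (-(D : ℝ) / 2) * (8 * Real.exp (-(1 / 4) * ∑ i, z i ^ 2)) with hg
  have hg0 : 0 ≤ ∫ z, g z := MeasureTheory.integral_nonneg fun z => by positivity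
  have hgi : MeasureTheory.Integrable g :=
    ((integrable_exp_neg_sum_sq (by norm_num)).const_mul 8).const_mul _
  refine ⟨(1 + κ ^ (α / 2)) * (∫ z, g z) + 1, by positivity, ?_⟩
  intro C hC hE L hL T hT φ hφ t₁ t₂ h₁ h₁₂ h₂ y₁ y₂
  have hF := hL.sum_sq_sub_le hδ hδδ hC hE h₁ h₁₂ h₂ hT.2
  rw [← hκ] at hF
  have hh : 0 < t₂ - t₁ := sub_pos.2 h₁₂
  have hH := hsemiSet_sSup_nonneg α φ
  set H := sSup (hsemiSet α φ) with hHdef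
  set R : ℝ := en (y₁ - y₂) ^ α + (t₂ - t₁) ^ (α / 2) with hR
  have hY : 0 ≤ en (y₁ - y₂) ^ α := Real.rpow_nonneg (en_nonneg _) _
  have hR0 : 0 ≤ R := by positivity
  have hincr : ∀ z : Fin D → ℝ,
      |φ (fun i => y₁ i - ∑ k, L t₁ T i k * z k) - φ (fun i => y₂ i - ∑ k, L t₂ T i k * z k)| ≤
        H * ((1 + κ ^ (α / 2)) * R * (1 + en z ^ α)) := fun z => by
    refine (abs_sub_le_hsemi hφ _ _).trans (mul_le_mul_of_nonneg_left ?_ hH)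
    have harg : (fun i => y₁ i - ∑ k, L t₁ T i k * z k) - (fun i => y₂ i - ∑ k, L t₂ T i k * z k)
        = (y₁ - y₂) - (L t₁ T - L t₂ T) *ᵥ z := by
      rw [Matrix.sub_mulVec]
      ext i
      simp only [Pi.sub_apply, mulVec, dotProduct]
      ring
    have hz : 0 ≤ en z ^ α := Real.rpow_nonneg (en_nonneg _) _
    have hmul : en ((L t₁ T - L t₂ T) *ᵥ z) ^ α ≤
        κ ^ (α / 2) * (t₂ - t₁) ^ (α / 2) * en z ^ α := by
      calc en ((L t₁ T - L t₂ T) *ᵥ z) ^ α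
          ≤ (Real.sqrt (κ * (t₂ - t₁)) * en z) ^ α := by
            refine Real.rpow_le_rpow (en_nonneg _) ((en_mulVec_le _ z).trans ?_) hα.1.le
            exact mul_le_mul_of_nonneg_right (Real.sqrt_le_sqrt hF) (en_nonneg z)
        _ = _ := by
            rw [Real.mul_rpow (Real.sqrt_nonneg _) (en_nonneg z), Real.sqrt_eq_rpow,
              ← Real.rpow_mul (by positivity), Real.mul_rpow hκ0 hh.le]
            ring_nf
    rw [harg]
    calc en ((y₁ - y₂) - (L t₁ T - L t₂ T) *ᵥ z) ^ α
        ≤ (en (y₁ - y₂) + en ((L t₁ T - L t₂ T) *ᵥ z)) ^ α :=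
          Real.rpow_le_rpow (en_nonneg _) (en_sub_le _ _) hα.1.le
      _ ≤ en (y₁ - y₂) ^ α + en ((L t₁ T - L t₂ T) *ᵥ z) ^ α :=
          Real.rpow_add_le_add_rpow (en_nonneg _) (en_nonneg _) hα.1.le hα.2.le
      _ ≤ R + κ ^ (α / 2) * R * en z ^ α := by
          refine add_le_add ?_ (hmul.trans ?_)
          · rw [hR]
            linarith [Real.rpow_nonneg hh.le (α / 2)]
          · gcongr
            rw [hR]
            linarith
      _ ≤ (1 + κ ^ (α / 2)) * R * (1 + en z ^ α) := by
          have : 0 ≤ κ ^ (α / 2) * R + R * en z ^ α := by positivity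
          linarith
  have hbound : ∀ z : Fin D → ℝ,
      ‖(2 * Real.pi) ^ (-(D : ℝ) / 2) * Real.exp (-(∑ i, z i ^ 2) / 2) *
          (φ (fun i => y₁ i - ∑ k, L t₁ T i k * z k) -
            φ (fun i => y₂ i - ∑ k, L t₂ T i k * z k))‖ ≤
        H * ((1 + κ ^ (α / 2)) * R) * g z := fun z => by
    rw [norm_mul, Real.norm_of_nonneg (by positivity), Real.norm_eq_abs]
    calc _ ≤ (2 * Real.pi) ^ (-(D : ℝ) / 2) * Real.exp (-(∑ i, z i ^ 2) / 2) *
          (H * ((1 + κ ^ (α / 2)) * R * (1 + en z ^ α))) := by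
          gcongr
          exact hincr z
      _ = H * ((1 + κ ^ (α / 2)) * R) * ((2 * Real.pi) ^ (-(D : ℝ) / 2) *
          ((1 + en z ^ α) * Real.exp (-(∑ i, z i ^ 2) / 2))) := by ring
      _ ≤ H * ((1 + κ ^ (α / 2)) * R) * g z := by
          refine mul_le_mul_of_nonneg_left (mul_le_mul_of_nonneg_left ?_ ?_) ?_
          · exact one_add_en_rpow_mul_exp_le hα z
          · positivity
          · positivity
  have hfinal := MeasureTheory.norm_integral_le_of_norm_le
    (hgi.const_mul (H * ((1 + κ ^ (α / 2)) * R)))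
    (Filter.Eventually.of_forall hbound)
  rw [Real.norm_eq_abs, MeasureTheory.integral_const_mul] at hfinal
  refine hfinal.trans ?_
  have : 0 ≤ H * R := by positivity
  linarith
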